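/- arXiv:1607.03081 — 2 statements merged into one kernel-verified Lean document; each statement's English description precedes it below -/
import Mathlib

section
/- Let v ∈ ℝⁿ and let H be a symmetric positive definite matrix such that F(p_H(v)) ≤ Q_H(p_H(v), v). Then for every x ∈ ℝⁿ, F(x) − F(p_H(v)) ≥ (1/2)‖p_H(v) − v‖_H² + ⟨v − x, p_H(v) − v⟩_H. -/
open scoped RealInnerProductSpace
open Finset

/-- Matrix-vector product, viewed as an operation on Euclidean space. -/
noncomputable def mulVecE {n : ℕ} (H : Matrix (Fin n) (Fin n) ℝ)
    (w : EuclideanSpace ℝ (Fin n)) : EuclideanSpace ℝ (Fin n) :=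
  (WithLp.equiv 2 (Fin n → ℝ)).symm (H.mulVec ((WithLp.equiv 2 (Fin n → ℝ)) w))

/-- The composite quadratic approximation
`Q_H(u,v) = f(v) + ⟨∇f(v), u−v⟩ + (1/2)⟨H(u−v), u−v⟩ + g(u)`. -/
noncomputable def Qa {n : ℕ} (f g : EuclideanSpace ℝ (Fin n) → ℝ)
    (H : Matrix (Fin n) (Fin n) ℝ) (u v : EuclideanSpace ℝ (Fin n)) : ℝ :=
  f v + ⟪ gradient f v, u - v ⟫ + (1 / 2) * ⟪ mulVecE H (u - v), u - v ⟫ + g u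

theorem mulVecE_add {n : ℕ} (H : Matrix (Fin n) (Fin n) ℝ) (a b : EuclideanSpace ℝ (Fin n)) :
    mulVecE H (a + b) = mulVecE H a + mulVecE H b := by
  ext i
  simp [mulVecE, Matrix.mulVec_add]

theorem mulVecE_smul {n : ℕ} (H : Matrix (Fin n) (Fin n) ℝ) (c : ℝ)
    (a : EuclideanSpace ℝ (Fin n)) : mulVecE H (c • a) = c • mulVecE H a := by
  ext i
  simp [mulVecE, Matrix.mulVec_smul]

theorem inner_mulVecE_comm {n : ℕ} {H : Matrix (Fin n) (Fin n) ℝ} (hH : H.IsHermitian)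
    (a b : EuclideanSpace ℝ (Fin n)) : ⟪mulVecE H a, b⟫ = ⟪mulVecE H b, a⟫ := by
  have hT : H.transpose = H := by simpa [Matrix.IsHermitian] using hH
  simp only [mulVecE, EuclideanSpace.inner_eq_star_dotProduct, star_trivial,
    WithLp.equiv_apply, WithLp.equiv_symm_apply]
  rw [Matrix.dotProduct_mulVec, ← Matrix.mulVec_transpose, hT, dotProduct_comm]

/-- A differentiable convex function lies above its tangent hyperplanes. -/
theorem ConvexOn.add_inner_gradient_le {E : Type*} [NormedAddCommGroup E]
    [InnerProductSpace ℝ E] [CompleteSpace E] {f : E → ℝ} (hf : ConvexOn ℝ Set.univ f)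
    {v : E} (hfv : DifferentiableAt ℝ f v) (x : E) :
    f v + ⟪gradient f v, x - v⟫ ≤ f x := by
  have hconv : ConvexOn ℝ Set.univ (f ∘ AffineMap.lineMap (k := ℝ) v x) := by
    simpa using hf.comp_affineMap (AffineMap.lineMap (k := ℝ) v x)
  have hline : HasDerivAt (AffineMap.lineMap (k := ℝ) v x) (x - v) (0 : ℝ) :=
    AffineMap.hasDerivAt_lineMap
  have hgrad : HasFDerivAt f (InnerProductSpace.toDual ℝ E (gradient f v))
      (AffineMap.lineMap v x (0 : ℝ)) := by
    simpa using hfv.hasGradientAt.hasFDerivAt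
  have hslope := hconv.le_slope_of_hasDerivAt (Set.mem_univ 0) (Set.mem_univ 1) one_pos
    (hgrad.comp_hasDerivAt 0 hline)
  simp only [slope_def_field, InnerProductSpace.toDual_apply_apply, Function.comp_apply,
    AffineMap.lineMap_apply_zero, AffineMap.lineMap_apply_one, sub_zero, div_one] at hslope
  linarith

theorem nonneg_of_forall_add_mul_nonneg {c k : ℝ}
    (h : ∀ t : ℝ, 0 < t → t ≤ 1 → 0 ≤ c + t * k) : 0 ≤ c := by
  by_contra! hc
  have hpos : 0 < -c + |k| := by positivity [neg_pos.2 hc]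
  have ht := h (-c / (-c + |k|)) (div_pos (neg_pos.2 hc) hpos)
    ((div_le_one hpos).2 (by linarith [abs_nonneg k]))
  rw [div_mul_eq_mul_div, ← sub_neg_eq_add, sub_nonneg, ← neg_div, div_le_iff₀ hpos] at ht
  nlinarith [mul_nonneg_of_nonpos_of_nonpos hc.le (sub_nonpos.2 (le_abs_self k)),
    mul_pos_of_neg_of_neg hc hc]

/-- First-order optimality condition for a minimizer of `Qa f g H · v`. -/
theorem Qa_minimizer_variational {n : ℕ} {f g : EuclideanSpace ℝ (Fin n) → ℝ}
    (hg : ConvexOn ℝ Set.univ g) {H : Matrix (Fin n) (Fin n) ℝ} (hH : H.IsHermitian)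
    {v p : EuclideanSpace ℝ (Fin n)} (hp : ∀ u, Qa f g H p v ≤ Qa f g H u v)
    (x : EuclideanSpace ℝ (Fin n)) :
    0 ≤ ⟪gradient f v, x - p⟫ + ⟪mulVecE H (p - v), x - p⟫ + (g x - g p) := by
  refine nonneg_of_forall_add_mul_nonneg (k := (1 / 2) * ⟪mulVecE H (x - p), x - p⟫)
    fun t ht0 ht1 => ?_
  have hmin := hp (p + t • (x - p))
  have hgt : g (p + t • (x - p)) ≤ (1 - t) * g p + t * g x := by
    have hconv := hg.2 (Set.mem_univ p) (Set.mem_univ x) (sub_nonneg.2 ht1) ht0.le (by ring)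
    have heq : (1 - t) • p + t • x = p + t • (x - p) := by module
    rwa [heq] at hconv
  have hsub : p + t • (x - p) - v = (p - v) + t • (x - p) := by module
  simp only [Qa, hsub, mulVecE_add, mulVecE_smul, inner_add_left, inner_add_right,
    real_inner_smul_left, real_inner_smul_right,
    inner_mulVecE_comm hH (x - p) (p - v)] at hmin
  refine nonneg_of_mul_nonneg_right ?_ ht0
  linarith

theorem stmt2 {n : ℕ} (f g : EuclideanSpace ℝ (Fin n) → ℝ)
    (hf : ConvexOn ℝ Set.univ f) (hfd : Differentiable ℝ f)
    (L : ℝ) (hL : 0 < L)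
    (hflip : ∀ x y, ‖gradient f x - gradient f y‖ ≤ L * ‖x - y‖)
    (hg : ConvexOn ℝ Set.univ g) (hgc : Continuous g)
    (H : Matrix (Fin n) (Fin n) ℝ) (hH : H.PosDef)
    (v p : EuclideanSpace ℝ (Fin n))
    (hp : ∀ u, Qa f g H p v ≤ Qa f g H u v)
    (hdec : f p + g p ≤ Qa f g H p v) :
    ∀ x, (f x + g x) - (f p + g p) ≥
      (1 / 2) * ⟪ mulVecE H (p - v), p - v ⟫ + ⟪ mulVecE H (v - x), p - v ⟫ := by
  intro x
  have hvar := Qa_minimizer_variational hg hH.isHermitian hp x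
  have htan := hf.add_inner_gradient_le (hfd v) x
  have hxv : x - v = (x - p) + (p - v) := by abel
  have hvx : v - x = (-1 : ℝ) • (x - p) + (-1 : ℝ) • (p - v) := by module
  rw [hxv, inner_add_right] at htan
  rw [hvx, mulVecE_add, mulVecE_smul, mulVecE_smul, inner_add_left, real_inner_smul_left,
    real_inner_smul_left, inner_mulVecE_comm hH.isHermitian (x - p) (p - v)]
  unfold Qa at hdec
  linarith
end

section
/- Let {σ_k}_{k≥1} be a sequence of positive real numbers and let {t_k}_{k≥1} be defined by t_1 = 1 and t_{k+1} = (1/2)(1 + √(1 + 4 (σ_k/σ_{k+1}) t_k²)) for k ≥ 1. Then for every k ≥ 1, σ_k t_k² ≥ ((Σ_{i=1}^{k} √σ_i)/2)². -/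
open Finset

theorem stmt14 (σ t : ℕ → ℝ) (hσ : ∀ k, 1 ≤ k → 0 < σ k)
    (ht1 : t 1 = 1)
    (htrec : ∀ k, 1 ≤ k →
      t (k + 1) = (1 / 2) * (1 + Real.sqrt (1 + 4 * (σ k / σ (k + 1)) * t k ^ 2))) :
    ∀ k : ℕ, 1 ≤ k →
      ((∑ i ∈ Finset.Icc 1 k, Real.sqrt (σ i)) / 2) ^ 2 ≤ σ k * t k ^ 2 := by
  have key : ∀ k : ℕ, 1 ≤ k →
      (∑ i ∈ Finset.Icc 1 k, Real.sqrt (σ i)) / 2 ≤ Real.sqrt (σ k) * t k := by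
    intro k hk
    induction k, hk using Nat.le_induction with
    | base =>
      rw [Finset.Icc_self, Finset.sum_singleton, ht1]
      linarith [Real.sqrt_nonneg (σ 1)]
    | succ k hk ih =>
      have hpos := Real.sqrt_pos.2 (hσ (k + 1) (by omega))
      have hle : 2 * (Real.sqrt (σ k) * t k / Real.sqrt (σ (k + 1))) ≤
          Real.sqrt (1 + 4 * (σ k / σ (k + 1)) * t k ^ 2) := by
        apply Real.le_sqrt_of_sq_le
        rw [mul_pow, div_pow, mul_pow, Real.sq_sqrt (hσ k hk).le,
          Real.sq_sqrt (hσ (k + 1) (by omega)).le, mul_div_right_comm]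
        linarith
      have hmul := mul_le_mul_of_nonneg_left hle hpos.le
      rw [mul_left_comm, mul_div_cancel₀ _ hpos.ne'] at hmul
      rw [Finset.sum_Icc_succ_top (by omega), htrec k hk]
      linarith
  intro k hk
  calc ((∑ i ∈ Finset.Icc 1 k, Real.sqrt (σ i)) / 2) ^ 2
      ≤ (Real.sqrt (σ k) * t k) ^ 2 :=
        pow_le_pow_left₀
          (div_nonneg (Finset.sum_nonneg fun i _ => Real.sqrt_nonneg _) zero_le_two) (key k hk) 2
    _ = σ k * t k ^ 2 := by rw [mul_pow, Real.sq_sqrt (hσ k hk).le]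
end
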